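/- Let 𝒯=(V,ℰ) be a leafless, locally finite rooted directed tree, q ≥ 1 a real number, and S_{λ,q} the Dirichlet shift on ℓ²(V). Let a ∈ ℂ and, for each branching vertex v ∈ V_≺, let b_v ∈ ℓ²(V) be supported in Chi(v) with Σ_{u∈Chi(v)} b_v(u) = 0, such that Σ_{v∈V_≺} ‖b_v‖² < ∞, and set f = a·e_root + Σ_{v∈V_≺} b_v. Then for every n ∈ ℕ, ‖S_{λ,q}^n f‖² = |a|²·(q)_n/(1)_n + Σ_{v∈V_≺} ‖b_v‖²·(n_v+q+1)_n/(n_v+2)_n. -/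

import Mathlib

open scoped ENNReal InnerProductSpace
open ContinuousLinearMap

noncomputable section

/-- A (countably infinite) rooted directed tree. -/
structure DirTree (V : Type) where
  edge : V → V → Prop
  not_self : ∀ v, ¬ edge v v
  no_circuit : ∀ v, ¬ Relation.TransGen edge v v
  connected : ∀ u v : V, Relation.ReflTransGen (fun a b => edge a b ∨ edge b a) u v
  uniq_parent : ∀ {u w v : V}, edge u v → edge w v → u = w
  root : V
  root_no_parent : ∀ u, ¬ edge u root
  root_uniq : ∀ v, (∀ u, ¬ edge u v) → v = root

namespace DirTree

variable {V : Type} (T : DirTree V)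

/-- The set of children of a vertex. -/
def chi (v : V) : Set V := {u | T.edge v u}

/-- Leafless: every vertex has a child. -/
def Leafless : Prop := ∀ v : V, ∃ u, T.edge v u

/-- Locally finite: every vertex has finitely many children. -/
def LocFin : Prop := ∀ v : V, (T.chi v).Finite

/-- The finset of children of a vertex (locally finite case). -/
def chiFin (hT : T.LocFin) (v : V) : Finset V := (hT v).toFinset

/-- Iterated child sets `Chi^⟨n⟩(W)`. -/
def chiIter (T : DirTree V) : ℕ → Set V → Set V
  | 0, W => W
  | n + 1, W => {u | ∃ v ∈ chiIter T n W, T.edge v u}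

/-- The depth of a vertex: the unique `n` with `v ∈ Chi^⟨n⟩(root)`. -/
def depth (v : V) : ℕ := sInf {n | v ∈ T.chiIter n {T.root}}

/-- The parent map (junk value at the root). -/
def par (v : V) : V :=
  letI := Classical.propDecidable (∃ u, T.edge u v)
  if h : ∃ u, T.edge u v then h.choose else v

end DirTree

/-- `ℓ²(V)`. -/
abbrev l2 (V : Type) := lp (fun _ : V => ℂ) 2

/-- The standard orthonormal basis vector `e_v` of `ℓ²(V)`. -/
def evec {V : Type} (v : V) : l2 V :=
  letI := Classical.decEq V
  lp.single 2 v 1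

/-- The Pochhammer symbol `(x)_k = x (x+1) ⋯ (x+k-1)`. -/
def poch (x : ℝ) (k : ℕ) : ℝ := ∏ i ∈ Finset.range k, (x + i)

namespace DirTree

variable {V : Type} (T : DirTree V)

/-- The weight `λ_{u,q}` (for any child `u` of `v`). -/
def wt (hT : T.LocFin) (q : ℝ) (v : V) : ℝ :=
  Real.sqrt (((T.depth v : ℝ) + q) / ((T.depth v : ℝ) + 1)) /
    Real.sqrt ((T.chiFin hT v).card)

/-- `S` is the Dirichlet shift with parameter `q` on `ℓ²(V)`:
`S e_v = ∑_{u ∈ Chi(v)} λ_{u,q} e_u`. -/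
def IsDirichletShift (hT : T.LocFin) (q : ℝ) (S : l2 V →L[ℂ] l2 V) : Prop :=
  ∀ v : V, S (evec v) = ∑ u ∈ T.chiFin hT v, ((T.wt hT q v : ℝ) : ℂ) • evec u

end DirTree

/-- The Cauchy dual `S (S*S)⁻¹` of a left-invertible operator. -/
def cauchyDual {V : Type} (S : l2 V →L[ℂ] l2 V) : l2 V →L[ℂ] l2 V :=
  S * Ring.inverse (ContinuousLinearMap.adjoint S * S)

/-! ### Depth -/

namespace DirTree

variable {V : Type} (T : DirTree V)

theorem mem_chiIter_succ {u v : V} (h : T.edge u v) {n : ℕ} :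
    v ∈ T.chiIter (n + 1) {T.root} ↔ u ∈ T.chiIter n {T.root} :=
  ⟨fun ⟨_, hw, hwv⟩ => T.uniq_parent h hwv ▸ hw, fun hu => ⟨u, hu, h⟩⟩

theorem not_mem_chiIter_zero {u v : V} (h : T.edge u v) :
    v ∉ T.chiIter 0 {T.root} := by
  rintro rfl
  exact T.root_no_parent u h

theorem chiIter_unique {n m : ℕ} {v : V} (hn : v ∈ T.chiIter n {T.root})
    (hm : v ∈ T.chiIter m {T.root}) : n = m := by
  induction n generalizing m v with
  | zero =>
    cases m with
    | zero => rfl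
    | succ m =>
      obtain ⟨w, -, hwv⟩ := hm
      exact absurd hn (T.not_mem_chiIter_zero hwv)
  | succ n ih =>
    obtain ⟨w, hw, hwv⟩ := hn
    cases m with
    | zero => exact absurd hm (T.not_mem_chiIter_zero hwv)
    | succ m => rw [ih hw ((T.mem_chiIter_succ hwv).1 hm)]

theorem exists_mem_chiIter (v : V) : ∃ n, v ∈ T.chiIter n {T.root} := by
  induction T.connected T.root v with
  | refl => exact ⟨0, rfl⟩
  | tail _ hstep ih =>
    obtain ⟨n, hn⟩ := ih
    rcases hstep with h | h
    · exact ⟨n + 1, (T.mem_chiIter_succ h).2 hn⟩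
    · cases n with
      | zero => exact absurd hn (T.not_mem_chiIter_zero h)
      | succ n => exact ⟨n, (T.mem_chiIter_succ h).1 hn⟩

theorem mem_chiIter_depth (v : V) : v ∈ T.chiIter (T.depth v) {T.root} :=
  Nat.sInf_mem (T.exists_mem_chiIter v)

theorem depth_root : T.depth T.root = 0 :=
  T.chiIter_unique (T.mem_chiIter_depth _) rfl

theorem depth_child {u v : V} (h : T.edge u v) : T.depth v = T.depth u + 1 :=
  T.chiIter_unique (T.mem_chiIter_depth v)
    ((T.mem_chiIter_succ h).2 (T.mem_chiIter_depth u))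

theorem mem_chiFin (hT : T.LocFin) {u v : V} : u ∈ T.chiFin hT v ↔ T.edge v u := by
  simp [chiFin, chi]

end DirTree

theorem inner_self_eq_ofReal_norm_sq {E : Type*} [NormedAddCommGroup E]
    [InnerProductSpace ℂ E] (x : E) : ⟪x, x⟫_ℂ = ((‖x‖ ^ 2 : ℝ) : ℂ) := by
  rw [inner_self_eq_norm_sq_to_K, Complex.ofReal_pow]
  rfl

/-! ### Coordinates in `ℓ²(V)` -/

section Coordinates

variable {V : Type}

theorem inner_evec_left (v : V) (x : l2 V) : ⟪evec v, x⟫_ℂ = x v := by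
  classical
  simp [evec, lp.inner_single_left]

theorem evec_apply_self (v : V) : evec v v = 1 := by
  simp [evec]

theorem evec_apply_of_ne {u v : V} (h : u ≠ v) : evec v u = 0 := by
  classical
  simp [evec, lp.single_apply, h]

theorem inner_evec_evec_of_ne {u v : V} (h : u ≠ v) : ⟪evec u, evec v⟫_ℂ = 0 := by
  rw [inner_evec_left, evec_apply_of_ne h]

theorem hasSum_smul_evec (x : l2 V) : HasSum (fun v => x v • evec v) x := by
  classical
  have h := lp.hasSum_single (p := 2) (by simp) x
  convert h using 2 with v
  rw [evec, ← lp.single_smul, smul_eq_mul, mul_one]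

theorem inner_eq_zero_of_disjoint {x y : l2 V} (h : ∀ u, x u = 0 ∨ y u = 0) :
    ⟪x, y⟫_ℂ = 0 := by
  rw [lp.inner_eq_tsum]
  refine (tsum_congr fun u => ?_).trans tsum_zero
  rcases h u with h | h <;> simp [h]

end Coordinates

/-! ### Homogeneous vectors and the Dirichlet shift -/

namespace DirTree

variable {V : Type} (T : DirTree V)

/-- The vector `x` is supported on the vertices of depth `m`. -/
def IsHomogeneous (m : ℕ) (x : l2 V) : Prop := ∀ u, T.depth u ≠ m → x u = 0

variable {T}

theorem IsHomogeneous.inner_eq_zero {m k : ℕ} (hmk : m ≠ k) {x y : l2 V}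
    (hx : T.IsHomogeneous m x) (hy : T.IsHomogeneous k y) : ⟪x, y⟫_ℂ = 0 :=
  inner_eq_zero_of_disjoint fun u => by
    by_cases h : T.depth u = m
    · exact .inr (hy u (h ▸ hmk))
    · exact .inl (hx u h)

namespace IsDirichletShift

variable {hT : T.LocFin} {q : ℝ} {S : l2 V →L[ℂ] l2 V}

theorem apply_evec_apply_eq_zero (hS : T.IsDirichletShift hT q S) {u v : V}
    (h : ¬ T.edge v u) : S (evec v) u = 0 := by
  rw [hS v, ← inner_evec_left, inner_sum]
  refine Finset.sum_eq_zero fun w hw => ?_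
  have hwu : u ≠ w := by
    rintro rfl
    exact h ((T.mem_chiFin hT).1 hw)
  rw [inner_smul_right, inner_evec_evec_of_ne hwu, mul_zero]

theorem apply_evec_apply (hS : T.IsDirichletShift hT q S) {u v : V}
    (h : T.edge v u) : S (evec v) u = T.wt hT q v := by
  rw [hS v, ← inner_evec_left, inner_sum, Finset.sum_eq_single u]
  · rw [inner_smul_right, inner_evec_left, evec_apply_self, mul_one]
  · intro w _ hw
    rw [inner_smul_right, inner_evec_evec_of_ne hw.symm, mul_zero]
  · exact fun hu => absurd ((T.mem_chiFin hT).2 h) hu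

theorem inner_apply_evec_of_ne (hS : T.IsDirichletShift hT q S) {v w : V} (h : v ≠ w) :
    ⟪S (evec v), S (evec w)⟫_ℂ = 0 :=
  inner_eq_zero_of_disjoint fun u => by
    by_cases hv : T.edge v u
    · exact .inr (hS.apply_evec_apply_eq_zero fun hw => h (T.uniq_parent hv hw))
    · exact .inl (hS.apply_evec_apply_eq_zero hv)

theorem inner_apply_evec_self (hL : T.Leafless) (hq : 1 ≤ q)
    (hS : T.IsDirichletShift hT q S) (v : V) :
    ⟪S (evec v), S (evec v)⟫_ℂ =
      ((((T.depth v : ℝ) + q) / ((T.depth v : ℝ) + 1) : ℝ) : ℂ) := by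
  obtain ⟨u, hu⟩ := hL v
  have hcard : (0 : ℝ) < (T.chiFin hT v).card :=
    Nat.cast_pos.2 (Finset.card_pos.2 ⟨u, (T.mem_chiFin hT).2 hu⟩)
  have hterm : ∀ w ∈ T.chiFin hT v,
      ⟪((T.wt hT q v : ℝ) : ℂ) • evec w, S (evec v)⟫_ℂ = ((T.wt hT q v ^ 2 : ℝ) : ℂ) := by
    intro w hw
    rw [inner_smul_left, inner_evec_left, hS.apply_evec_apply ((T.mem_chiFin hT).1 hw),
      Complex.conj_ofReal, sq, Complex.ofReal_mul]
  nth_rewrite 1 [hS v]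
  rw [sum_inner, Finset.sum_congr rfl hterm, Finset.sum_const, nsmul_eq_mul,
    ← Complex.ofReal_natCast, ← Complex.ofReal_mul, wt, div_pow,
    Real.sq_sqrt (by positivity), Real.sq_sqrt hcard.le, mul_div_cancel₀ _ hcard.ne']

theorem inner_apply_evec_apply (hL : T.Leafless) (hq : 1 ≤ q)
    (hS : T.IsDirichletShift hT q S) (v : V) (x : l2 V) :
    ⟪S (evec v), S x⟫_ℂ =
      ((((T.depth v : ℝ) + q) / ((T.depth v : ℝ) + 1) : ℝ) : ℂ) * x v := by
  have h := ((hasSum_smul_evec x).mapL S).mapL (innerSL ℂ (S (evec v)))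
  refine h.unique ?_
  convert hasSum_single v ?_ using 1
  · rw [map_smul, map_smul, innerSL_apply_apply, hS.inner_apply_evec_self hL hq, smul_eq_mul,
      mul_comm]
  · intro w hw
    simp [hS.inner_apply_evec_of_ne hw.symm]

theorem inner_apply_apply (hL : T.Leafless) (hq : 1 ≤ q)
    (hS : T.IsDirichletShift hT q S) {m : ℕ} {x : l2 V} (hx : T.IsHomogeneous m x)
    (y : l2 V) :
    ⟪S y, S x⟫_ℂ = ((((m : ℝ) + q) / ((m : ℝ) + 1) : ℝ) : ℂ) * ⟪y, x⟫_ℂ := by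
  have hadj : adjoint S (S x) = ((((m : ℝ) + q) / ((m : ℝ) + 1) : ℝ) : ℂ) • x := by
    ext v
    rw [← inner_evec_left, adjoint_inner_right, hS.inner_apply_evec_apply hL hq,
      lp.coeFn_smul, Pi.smul_apply, smul_eq_mul]
    by_cases hv : T.depth v = m
    · rw [hv]
    · rw [hx v hv, mul_zero, mul_zero]
  rw [← adjoint_inner_right, hadj, inner_smul_right]

theorem isHomogeneous_apply (hS : T.IsDirichletShift hT q S) {m : ℕ} {x : l2 V}
    (hx : T.IsHomogeneous m x) : T.IsHomogeneous (m + 1) (S x) := by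
  intro u hu
  have h := ((hasSum_smul_evec x).mapL S).mapL (innerSL ℂ (evec u))
  rw [← inner_evec_left]
  refine h.unique ?_
  convert hasSum_zero using 2 with v
  simp only [map_smul, innerSL_apply_apply, smul_eq_mul, inner_evec_left]
  by_cases hv : T.depth v = m
  · rw [hS.apply_evec_apply_eq_zero, mul_zero]
    intro hvu
    exact hu (by rw [T.depth_child hvu, hv])
  · rw [hx v hv, zero_mul]

theorem isHomogeneous_pow_apply (hS : T.IsDirichletShift hT q S) {m : ℕ} {x : l2 V}
    (hx : T.IsHomogeneous m x) (n : ℕ) : T.IsHomogeneous (m + n) ((S ^ n) x) := by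
  induction n with
  | zero => exact hx
  | succ n ih =>
    rw [pow_succ']
    exact hS.isHomogeneous_apply ih

theorem inner_pow_apply (hL : T.Leafless) (hq : 1 ≤ q)
    (hS : T.IsDirichletShift hT q S) {m : ℕ} {x : l2 V} (hx : T.IsHomogeneous m x)
    (y : l2 V) (n : ℕ) :
    ⟪(S ^ n) y, (S ^ n) x⟫_ℂ =
      ((poch ((m : ℝ) + q) n / poch ((m : ℝ) + 1) n : ℝ) : ℂ) * ⟪y, x⟫_ℂ := by
  induction n with
  | zero => simp [poch]
  | succ n ih =>
    rw [pow_succ', mul_apply_eq_comp, mul_apply_eq_comp,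
      hS.inner_apply_apply hL hq (hS.isHomogeneous_pow_apply hx n), ih, ← mul_assoc,
      ← Complex.ofReal_mul, div_mul_div_comm, poch, poch, poch, poch,
      Finset.prod_range_succ, Finset.prod_range_succ]
    congr 3 <;> push_cast <;> ring

theorem norm_sq_pow_apply (hL : T.Leafless) (hq : 1 ≤ q)
    (hS : T.IsDirichletShift hT q S) {m : ℕ} {x : l2 V} (hx : T.IsHomogeneous m x)
    (n : ℕ) :
    ‖(S ^ n) x‖ ^ 2 = ‖x‖ ^ 2 * (poch ((m : ℝ) + q) n / poch ((m : ℝ) + 1) n) := by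
  have h := hS.inner_pow_apply hL hq hx x n
  rw [inner_self_eq_ofReal_norm_sq, inner_self_eq_ofReal_norm_sq] at h
  rw [mul_comm]
  exact_mod_cast h

theorem inner_pow_apply_eq_zero (hL : T.Leafless) (hq : 1 ≤ q)
    (hS : T.IsDirichletShift hT q S) {k : ℕ} {x y : l2 V} (hy : T.IsHomogeneous k y)
    (hxy : ⟪x, y⟫_ℂ = 0) (n : ℕ) :
    ⟪(S ^ n) x, (S ^ n) y⟫_ℂ = 0 := by
  rw [hS.inner_pow_apply hL hq hy, hxy, mul_zero]

end IsDirichletShift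

end DirTree

/-- Pythagoras' theorem for the sum of a family of pairwise orthogonal vectors. -/
theorem hasSum_norm_sq_of_pairwise_inner_eq_zero {ι E : Type*} [NormedAddCommGroup E]
    [InnerProductSpace ℂ E] {g : ι → E} {G : E} (hG : HasSum g G)
    (horth : Pairwise fun i j => ⟪g i, g j⟫_ℂ = 0) :
    HasSum (fun i => ‖g i‖ ^ 2) (‖G‖ ^ 2) := by
  have hinner : ∀ i, ⟪g i, G⟫_ℂ = ((‖g i‖ ^ 2 : ℝ) : ℂ) := by
    intro i
    refine (hG.mapL (innerSL ℂ (g i))).unique ?_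
    rw [← inner_self_eq_ofReal_norm_sq]
    exact hasSum_single i fun j hj => horth hj.symm
  have h := hG.mapL (innerSL ℂ G)
  have hre := h.mapL Complex.reCLM
  convert hre using 1
  · ext i
    rw [innerSL_apply_apply, ← inner_conj_symm, hinner]
    simp [-Complex.ofReal_pow]
  · rw [innerSL_apply_apply, inner_self_eq_ofReal_norm_sq, Complex.reCLM_apply,
      Complex.ofReal_re]

theorem stmt_8 {V : Type} [Countable V] [Infinite V] (T : DirTree V)
    (hL : T.Leafless) (hT : T.LocFin) (q : ℝ) (hq : 1 ≤ q)
    (S : l2 V →L[ℂ] l2 V) (hS : T.IsDirichletShift hT q S)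
    (a : ℂ) (b : {v : V // 2 ≤ (T.chiFin hT v).card} → l2 V)
    (hsupp : ∀ (v : {v : V // 2 ≤ (T.chiFin hT v).card}) (u : V),
      u ∉ T.chi v.1 → b v u = 0)
    (hzero : ∀ v : {v : V // 2 ≤ (T.chiFin hT v).card},
      ∑ u ∈ T.chiFin hT v.1, b v u = 0)
    (hnorm : Summable fun v : {v : V // 2 ≤ (T.chiFin hT v).card} => ‖b v‖ ^ 2)
    (F : l2 V) (hF : HasSum b F) (f : l2 V) (hf : f = a • evec T.root + F) :
    ∀ n : ℕ, ‖(S ^ n) f‖ ^ 2 =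
      ‖a‖ ^ 2 * (poch q n / poch 1 n) +
        ∑' v : {v : V // 2 ≤ (T.chiFin hT v).card},
          ‖b v‖ ^ 2 * (poch ((T.depth v.1 : ℝ) + q + 1) n / poch ((T.depth v.1 : ℝ) + 2) n) := by
  intro n
  have hroot : T.IsHomogeneous 0 (evec T.root) := fun u hu =>
    evec_apply_of_ne fun h => hu (h ▸ T.depth_root)
  have hb : ∀ v, T.IsHomogeneous (T.depth v.1 + 1) (b v) := fun v u hu =>
    hsupp v u fun h => hu (T.depth_child h)
  have horth : Pairwise fun v w => ⟪b v, b w⟫_ℂ = 0 := fun v w hvw =>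
    inner_eq_zero_of_disjoint fun u => by
      by_cases hv : u ∈ T.chi v.1
      · exact .inr (hsupp w u fun hw => hvw (Subtype.ext (T.uniq_parent hv hw)))
      · exact .inl (hsupp v u hv)
  have hSF : HasSum (fun v => (S ^ n) (b v)) ((S ^ n) F) := hF.mapL (S ^ n)
  have hcross : ⟪(S ^ n) (a • evec T.root), (S ^ n) F⟫_ℂ = 0 := by
    refine (hSF.mapL (innerSL ℂ ((S ^ n) (a • evec T.root)))).unique ?_
    convert hasSum_zero using 2 with v
    rw [innerSL_apply_apply, map_smul, inner_smul_left,
      hS.inner_pow_apply_eq_zero hL hq (hb v)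
        (hroot.inner_eq_zero (Nat.succ_ne_zero _).symm (hb v)), mul_zero]
  have hpyth : ‖(S ^ n) f‖ ^ 2 = ‖(S ^ n) (a • evec T.root)‖ ^ 2 + ‖(S ^ n) F‖ ^ 2 := by
    rw [hf, map_add, sq, sq, sq]
    exact norm_add_sq_eq_norm_sq_add_norm_sq_of_inner_eq_zero _ _ hcross
  have hnorm_root : ‖(evec T.root : l2 V)‖ ^ 2 = 1 := by
    have h := inner_evec_left T.root (evec T.root)
    rw [inner_self_eq_ofReal_norm_sq, evec_apply_self] at h
    exact_mod_cast h
  rw [hpyth, map_smul, norm_smul, mul_pow, hS.norm_sq_pow_apply hL hq hroot, hnorm_root,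
    one_mul, Nat.cast_zero, zero_add, zero_add,
    ← (hasSum_norm_sq_of_pairwise_inner_eq_zero hSF fun v w hvw =>
      hS.inner_pow_apply_eq_zero hL hq (hb w) (horth hvw) n).tsum_eq]
  congr 1
  refine tsum_congr fun v => ?_
  rw [hS.norm_sq_pow_apply hL hq (hb v)]
  congr 3 <;> push_cast <;> ring

end
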